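/- Let s be a non-empty string and suppose the family S(s,·) satisfies Eq.(★) for s. Let v' = sufpal(s,|s|), the longest palindromic suffix of s, and let s' = s[1..|s|−1]. Define, for each non-empty palindromic substring v of s': S(s',v) = (S(s,v) \ {|s| − |v| + 1}) ∪ {|s| − |v'| + 1} if v = link(v') and |link(v')| ≥ 1, and S(s',v) = S(s,v) \ {|s| − |v| + 1} otherwise. Then the family S(s',·) satisfies Eq.(★) for s'. -/

import Mathlib

noncomputable section
open scoped Classical

namespace DEE

variable {α : Type*}

/-- 1-indexed substring `s[i..j]` (empty if `i > j`). -/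
def substr (s : List α) (i j : ℕ) : List α := (s.drop (i - 1)).take (j + 1 - i)

/-- Set of start positions (1-indexed) of occurrences of `t` in `s`. -/
def occ (s t : List α) : Set ℕ :=
  {i | 1 ≤ i ∧ i + t.length - 1 ≤ s.length ∧ (s.drop (i - 1)).take t.length = t}

/-- `v` is a non-empty palindromic substring of `s`. -/
def IsPalSub (s v : List α) : Prop := v ≠ [] ∧ v.Palindrome ∧ v <:+: s

/-- `prelen s i`: length of the longest palindromic prefix of `s[i..|s|]`. -/
def prelen (s : List α) (i : ℕ) : ℕ :=
  sSup {l | 1 ≤ l ∧ l ≤ s.length + 1 - i ∧ (substr s i (i + l - 1)).Palindrome}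

/-- `suflen s i`: length of the longest palindromic suffix of `s[1..i]`. -/
def suflen (s : List α) (i : ℕ) : ℕ :=
  sSup {l | 1 ≤ l ∧ l ≤ i ∧ (substr s (i + 1 - l) i).Palindrome}

/-- longest palindromic prefix of `s[i..|s|]`. -/
def prepal (s : List α) (i : ℕ) : List α := substr s i (i + prelen s i - 1)

/-- longest palindromic suffix of `s[1..i]`. -/
def sufpal (s : List α) (i : ℕ) : List α := substr s (i + 1 - suflen s i) i

/-- The occurrence `s[i..j]` is a surface in `s`. -/
def Surface (s : List α) (i j : ℕ) : Prop :=
  1 ≤ i ∧ i ≤ j ∧ j ≤ s.length ∧ (substr s i j).Palindrome ∧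
    (∀ l, 1 ≤ l → l < i → ¬ (substr s l j).Palindrome) ∧
    (∀ r, j < r → r ≤ s.length → ¬ (substr s i r).Palindrome)

/-- length of the longest proper palindromic suffix of `t`. -/
def linklen (t : List α) : ℕ :=
  sSup {l | l < t.length ∧ (t.drop (t.length - l)).Palindrome}

/-- the longest proper palindromic suffix of `t` (possibly `[]`). -/
def link (t : List α) : List α := t.drop (t.length - linklen t)

/-- `overline-occ`: shifted occurrences `{i + |t| - |link t| : i ∈ occ s t}`. -/
def obar (s t : List α) : Set ℕ := (fun i => i + t.length - (link t).length) '' occ s t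

/-- Eq.(★): the family `S` of reduced occurrence sets represents `occ` for `s`. -/
def SatStar (s : List α) (S : List α → Set ℕ) : Prop :=
  ∀ v, IsPalSub s v →
    occ s v = S v ∪ ⋃ u ∈ {u : List α | IsPalSub s u ∧ link u = v}, (occ s u ∪ obar s u)

/-- number of non-empty palindromic substrings of `s` linking to `v`. -/
def linkcnt (s v : List α) : ℕ := {u | IsPalSub s u ∧ link u = v}.ncard

def precnt (s v : List α) : ℕ := {i | 1 ≤ i ∧ i ≤ s.length ∧ prepal s i = v}.ncard

def sufcnt (s v : List α) : ℕ := {i | 1 ≤ i ∧ i ≤ s.length ∧ sufpal s i = v}.ncard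

def cnt (s v : List α) : ℕ := sufcnt s v

/-- surfaced occurrences of `v` in `s`. -/
def surf (s v : List α) : Set ℕ := {i ∈ occ s v | Surface s i (i + v.length - 1)}

def presurf (s : List α) (i : ℕ) : List α :=
  if Surface s i (i + prelen s i - 1) then prepal s i else []

def sufsurf (s : List α) (i : ℕ) : List α :=
  if Surface s (i + 1 - suflen s i) i then sufpal s i else []

end DEE
namespace DEE

variable {α : Type*}

theorem mem_occ_iff {s t : List α} {i : ℕ} :
    i ∈ occ s t ↔ ∃ a b, s = a ++ t ++ b ∧ i = a.length + 1 := by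
  constructor
  · rintro ⟨h1, h2, h3⟩
    refine ⟨s.take (i - 1), (s.drop (i - 1)).drop t.length, ?_, ?_⟩
    · conv_rhs => enter [1, 2]; rw [← h3]
      rw [List.append_assoc, List.take_append_drop, List.take_append_drop]
    · rw [List.length_take]; omega
  · rintro ⟨a, b, rfl, rfl⟩
    refine ⟨by omega, by simp, by simp⟩

theorem mem_occ_dropLast_iff {s t : List α} (ht : t ≠ []) {i : ℕ} :
    i ∈ occ s.dropLast t ↔ i ∈ occ s t ∧ i ≠ s.length - t.length + 1 := by
  constructor
  · intro h
    obtain ⟨a, b, hab, rfl⟩ := mem_occ_iff.1 h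
    have hs : s ≠ [] := by
      rintro rfl
      simp [ht] at hab
    have hs' := List.dropLast_append_getLast hs
    rw [hab] at hs'
    refine ⟨mem_occ_iff.2 ⟨a, b ++ [s.getLast hs], by simpa using hs'.symm, rfl⟩, ?_⟩
    have := congrArg List.length hs'
    simp at this
    omega
  · rintro ⟨h, hne⟩
    obtain ⟨a, b, rfl, rfl⟩ := mem_occ_iff.1 h
    have hb : b ≠ [] := by
      rintro rfl
      simp at hne
    exact mem_occ_iff.2 ⟨a, b.dropLast, by rw [List.dropLast_append_of_ne_nil hb], rfl⟩

theorem isPalSub_of_mem_occ {s t : List α} {i : ℕ} (hne : t ≠ []) (hp : t.Palindrome)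
    (h : i ∈ occ s t) : IsPalSub s t := by
  obtain ⟨a, b, rfl, -⟩ := mem_occ_iff.1 h
  exact ⟨hne, hp, a, b, rfl⟩

theorem isPalSub_of_dropLast {s t : List α} (h : IsPalSub s.dropLast t) : IsPalSub s t :=
  ⟨h.1, h.2.1, h.2.2.trans (List.dropLast_prefix s).isInfix⟩

theorem linklen_mem {t : List α} (ht : t ≠ []) :
    linklen t < t.length ∧ (t.drop (t.length - linklen t)).Palindrome := by
  have hne : {l | l < t.length ∧ (t.drop (t.length - l)).Palindrome}.Nonempty :=
    ⟨0, List.length_pos_iff.2 ht, by simpa using List.Palindrome.nil⟩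
  exact Nat.sSup_mem hne ⟨t.length, fun l hl => hl.1.le⟩

theorem length_link {t : List α} (ht : t ≠ []) : (link t).length = linklen t := by
  have := (linklen_mem ht).1
  rw [link, List.length_drop]; omega

theorem length_link_lt {t : List α} (ht : t ≠ []) : (link t).length < t.length := by
  rw [length_link ht]; exact (linklen_mem ht).1

theorem palindrome_link {t : List α} (ht : t ≠ []) : (link t).Palindrome :=
  (linklen_mem ht).2

theorem link_suffix (t : List α) : link t <:+ t := List.drop_suffix _ _

theorem link_prefix {t : List α} (ht : t ≠ []) (hp : t.Palindrome) : link t <+: t := by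
  have := List.reverse_prefix.2 (link_suffix t)
  rwa [hp.reverse_eq, (palindrome_link ht).reverse_eq] at this

theorem length_le_length_link {t q : List α} (hq : q.Palindrome) (hqt : q <:+ t)
    (hlt : q.length < t.length) : q.length ≤ (link t).length := by
  have ht : t ≠ [] := by rintro rfl; simp at hlt
  rw [length_link ht]
  exact le_csSup ⟨t.length, fun l hl => hl.1.le⟩ ⟨hlt, by rwa [← List.suffix_iff_eq_drop.1 hqt]⟩

theorem substr_suffix (s : List α) {l : ℕ} (hl : l ≤ s.length) :
    substr s (s.length + 1 - l) s.length = s.drop (s.length - l) := by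
  rw [substr, List.take_of_length_le]
  · congr 1; omega
  · rw [List.length_drop]; omega

theorem suflen_mem {s : List α} (hs : s ≠ []) :
    1 ≤ suflen s s.length ∧ suflen s s.length ≤ s.length ∧
      (substr s (s.length + 1 - suflen s s.length) s.length).Palindrome := by
  have hpos := List.length_pos_iff.2 hs
  have hne : {l | 1 ≤ l ∧ l ≤ s.length ∧
      (substr s (s.length + 1 - l) s.length).Palindrome}.Nonempty := by
    refine ⟨1, le_rfl, hpos, ?_⟩
    rw [substr_suffix s hpos, List.drop_length_sub_one hs]
    exact List.Palindrome.singleton _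
  exact Nat.sSup_mem hne ⟨s.length, fun l hl => hl.2.1⟩

theorem sufpal_eq_drop {s : List α} (hs : s ≠ []) :
    sufpal s s.length = s.drop (s.length - suflen s s.length) :=
  substr_suffix s (suflen_mem hs).2.1

theorem length_sufpal {s : List α} (hs : s ≠ []) :
    (sufpal s s.length).length = suflen s s.length := by
  have := suflen_mem hs
  rw [sufpal_eq_drop hs, List.length_drop]; omega

theorem sufpal_ne_nil {s : List α} (hs : s ≠ []) : sufpal s s.length ≠ [] := by
  have := (suflen_mem hs).1
  rw [← List.length_pos_iff, length_sufpal hs]; omega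

theorem palindrome_sufpal {s : List α} (hs : s ≠ []) : (sufpal s s.length).Palindrome :=
  (suflen_mem hs).2.2

theorem sufpal_suffix {s : List α} (hs : s ≠ []) : sufpal s s.length <:+ s := by
  rw [sufpal_eq_drop hs]; exact List.drop_suffix _ _

theorem length_le_length_sufpal {s q : List α} (hne : q ≠ []) (hq : q.Palindrome)
    (hqs : q <:+ s) : q.length ≤ (sufpal s s.length).length := by
  have hs : s ≠ [] := by rintro rfl; exact hne (List.suffix_nil.1 hqs)
  rw [length_sufpal hs]
  refine le_csSup ⟨s.length, fun l hl => hl.2.1⟩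
    ⟨List.length_pos_iff.2 hne, hqs.length_le, ?_⟩
  rwa [substr_suffix s hqs.length_le, ← List.suffix_iff_eq_drop.1 hqs]

/-- Among the palindromic suffixes of `q` longer than `v`, the shortest one links to `v`. -/
theorem exists_suffix_link_eq {q v : List α} (hq : q.Palindrome) (hv : v.Palindrome)
    (hvq : v <:+ q) (hlt : v.length < q.length) :
    ∃ u, u <:+ q ∧ u.Palindrome ∧ u ≠ [] ∧ link u = v := by
  have hex : ∃ l, ∃ u, u <:+ q ∧ u.Palindrome ∧ v.length < u.length ∧ u.length = l :=
    ⟨_, q, List.suffix_rfl, hq, hlt, rfl⟩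
  obtain ⟨u, huq, hu, hvu, hul⟩ := Nat.find_spec hex
  have hne : u ≠ [] := by rintro rfl; simp at hvu
  have hvsu : v <:+ u := List.suffix_of_suffix_length_le hvq huq hvu.le
  refine ⟨u, huq, hu, hne, ?_⟩
  have hle := length_le_length_link hv hvsu hvu
  have hge : (link u).length ≤ v.length := by
    by_contra! hcon
    have := Nat.find_min' hex
      ⟨link u, (link_suffix u).trans huq, palindrome_link hne, hcon, rfl⟩
    have := length_link_lt hne
    omega
  exact ((List.suffix_of_suffix_length_le hvsu (link_suffix u) hle).eq_of_length
    (by omega)).symm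

/-- The smallest period of a palindrome is at most that of any palindrome properly extending it. -/
theorem length_le_length_add_link {c u : List α} (hc : c ≠ []) (hu : u.Palindrome)
    (hw : (c ++ u).Palindrome) : u.length ≤ c.length + (link u).length := by
  by_contra! hcon
  have hrev : c ++ u = u ++ c.reverse := by
    have := hw.reverse_eq
    rw [List.reverse_append, hu.reverse_eq] at this
    exact this.symm
  have hcu : c <+: u :=
    List.prefix_of_prefix_length_le ⟨u, rfl⟩ ⟨c.reverse, hrev.symm⟩ (by omega)
  obtain ⟨d, rfl⟩ := hcu
  have hd : d <+: c ++ d := by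
    rw [List.append_assoc c d, List.append_cancel_left_eq] at hrev
    exact List.prefix_of_prefix_length_le ⟨c.reverse, hrev.symm⟩ List.prefix_rfl (by simp)
  have hd' : d.reverse <+: c ++ d := by
    have h := List.prefix_append d.reverse c.reverse
    rwa [← List.reverse_append, hu.reverse_eq] at h
  have hdp : d.Palindrome := .of_reverse_eq
    ((List.prefix_of_prefix_length_le hd' hd (by simp)).eq_of_length (by simp))
  have hpos := List.length_pos_iff.2 hc
  have := length_le_length_link hdp (List.suffix_append c d) (by simp; omega)
  simp at hcon
  omega

theorem occ_subset_occ_link {s u : List α} (hne : u ≠ []) (hu : u.Palindrome) :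
    occ s u ⊆ occ s (link u) := by
  intro i hi
  obtain ⟨a, b, rfl, rfl⟩ := mem_occ_iff.1 hi
  obtain ⟨e, he⟩ := link_prefix hne hu
  refine mem_occ_iff.2 ⟨a, e ++ b, ?_, rfl⟩
  conv_lhs => rw [← he]
  simp

theorem obar_subset_occ_link (s u : List α) : obar s u ⊆ occ s (link u) := by
  rintro _ ⟨i, hi, rfl⟩
  obtain ⟨a, b, rfl, rfl⟩ := mem_occ_iff.1 hi
  obtain ⟨e, he⟩ := link_suffix u
  refine mem_occ_iff.2 ⟨a ++ e, b, ?_, ?_⟩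
  · conv_lhs => rw [← he]
    simp
  · have := congrArg List.length he
    simp at this ⊢
    omega

/-- If a palindromic suffix `u` of `s` is properly contained in a longer palindromic suffix,
then the prefix occurrence of `link u` in `u` is recorded by a palindrome ending before the last
letter of `s`. -/
theorem exists_obar_dropLast {g c u : List α} (hc : c ≠ []) (hne : u ≠ []) (hu : u.Palindrome)
    (hw : (c ++ u).Palindrome) :
    ∃ z, IsPalSub (g ++ (c ++ u)).dropLast z ∧ link z = link u ∧
      (g ++ c).length + 1 ∈ obar (g ++ (c ++ u)).dropLast z := by
  have hper := length_le_length_add_link hc hu hw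
  have hlt := length_link_lt hne
  have hv := palindrome_link hne
  obtain ⟨e, he⟩ := link_prefix hne hu
  generalize hvdef : link u = v at *
  subst he
  have he0 : e ≠ [] := by rintro rfl; simp at hlt
  have hrev : c ++ (v ++ e) = e.reverse ++ (v ++ c.reverse) := by
    have := hw.reverse_eq
    simp only [List.reverse_append, hv.reverse_eq, List.append_assoc] at this
    exact this.symm
  obtain ⟨f, rfl⟩ : e.reverse <+: c :=
    List.prefix_of_prefix_length_le ⟨_, hrev.symm⟩ ⟨_, rfl⟩ (by simp at hper ⊢; omega)
  have hx : (f ++ v).Palindrome := by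
    refine .of_reverse_eq ?_
    simp only [List.reverse_append, List.reverse_reverse, List.append_assoc,
      List.append_cancel_left_eq] at hrev
    rw [← List.append_assoc, ← List.append_assoc, List.append_cancel_right_eq] at hrev
    rw [List.reverse_append, hv.reverse_eq, hrev]
  have key : ∀ z a, z ≠ [] → z.Palindrome → link z = v →
      g ++ (e.reverse ++ f ++ (v ++ e)) = a ++ z ++ e →
      ∃ z, IsPalSub (g ++ (e.reverse ++ f ++ (v ++ e))).dropLast z ∧ link z = v ∧
        (g ++ (e.reverse ++ f)).length + 1 ∈
          obar (g ++ (e.reverse ++ f ++ (v ++ e))).dropLast z := by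
    intro z a hz hzp hlz heq
    have hocc : a.length + 1 ∈ occ (g ++ (e.reverse ++ f ++ (v ++ e))).dropLast z :=
      mem_occ_iff.2 ⟨a, e.dropLast, by rw [heq, List.dropLast_append_of_ne_nil he0], rfl⟩
    refine ⟨z, isPalSub_of_mem_occ hz hzp hocc, hlz, _, hocc, ?_⟩
    have := congrArg List.length heq
    rw [hlz]
    simp at this ⊢
    omega
  by_cases hf : f = []
  · subst hf
    refine key (v ++ e) g hne hu hvdef ?_
    conv_rhs => rw [← hu.reverse_eq, List.reverse_append, hv.reverse_eq]
    simp
  · obtain ⟨z, ⟨h, hz⟩, hzp, hz0, hlz⟩ := exists_suffix_link_eq hx hv (List.suffix_append f v)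
      (by simpa using List.length_pos_iff.2 hf)
    refine key z (g ++ e.reverse ++ h) hz0 hzp hlz ?_
    have : f ++ (v ++ e) = h ++ (z ++ e) := by
      rw [← List.append_assoc, ← hz, List.append_assoc]
    simp [this]

end DEE

/-- (`pop_back` correctness.) Let `v'` be the longest palindromic
suffix of non-empty `s` and `s' = s[1..|s|-1]`. Removing the final occurrence position
`|s| - |v| + 1` from each `S(v)`, and inserting `|s| - |v'| + 1` into `S(link v')` when
`|link v'| ≥ 1`, yields a family satisfying Eq.(★) for `s'`. -/
theorem pop_back_occurrence_recording {α : Type*} (s : List α) (hs : s ≠ [])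
    (S : List α → Set ℕ) (hS : DEE.SatStar s S) :
    DEE.SatStar s.dropLast
      (fun v =>
        if v = DEE.link (DEE.sufpal s s.length) ∧
            1 ≤ (DEE.link (DEE.sufpal s s.length)).length then
          (S v \ {s.length - v.length + 1}) ∪
            {s.length - (DEE.sufpal s s.length).length + 1}
        else S v \ {s.length - v.length + 1}) := by
  have hp0 := DEE.sufpal_ne_nil hs
  have hpp := DEE.palindrome_sufpal hs
  have hps := DEE.sufpal_suffix hs
  have hpmax := fun q : List α => DEE.length_le_length_sufpal (s := s) (q := q)
  generalize DEE.sufpal s s.length = p at *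
  intro v hv
  have hv0 := hv.1
  have hSv := hS v (DEE.isPalSub_of_dropLast hv)
  apply Set.Subset.antisymm
  · intro i hi
    obtain ⟨his, hilast⟩ := (DEE.mem_occ_dropLast_iff hv0).1 hi
    rw [hSv] at his
    rcases his with hiS | hiU
    · left
      dsimp only
      split_ifs
      · exact Or.inl ⟨hiS, hilast⟩
      · exact ⟨hiS, hilast⟩
    · simp only [Set.mem_iUnion] at hiU
      obtain ⟨u, ⟨hu, rfl⟩, hiu⟩ := hiU
      have hu0 := hu.1
      have hlt := DEE.length_link_lt hu0
      have record : ∀ z, DEE.IsPalSub s.dropLast z → DEE.link z = DEE.link u →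
          i ∈ DEE.occ s.dropLast z ∪ DEE.obar s.dropLast z →
          i ∈ ⋃ u' ∈ {u' | DEE.IsPalSub s.dropLast u' ∧ DEE.link u' = DEE.link u},
            (DEE.occ s.dropLast u' ∪ DEE.obar s.dropLast u') := by
        intro z hz hzl hiz
        simp only [Set.mem_iUnion]
        exact ⟨z, ⟨hz, hzl⟩, hiz⟩
      rcases hiu with hiu | ⟨k, hk, rfl⟩
      · by_cases hlast : i = s.length - u.length + 1
        · obtain ⟨a, b, hab, hia⟩ := DEE.mem_occ_iff.1 hiu
          have hb : b = [] := by
            rw [← List.length_eq_zero_iff]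
            have := congrArg List.length hab
            simp at this
            omega
          subst hb
          rw [List.append_nil] at hab
          have hus : u <:+ s := ⟨a, hab.symm⟩
          have hup := List.suffix_of_suffix_length_le hus hps (hpmax u hu0 hu.2.1 hus)
          obtain ⟨c, hc⟩ := hup
          by_cases hc0 : c = []
          · subst hc0
            rw [List.nil_append] at hc
            subst hc
            left
            dsimp only
            rw [if_pos ⟨rfl, List.length_pos_iff.2 hv0⟩]
            exact Or.inr hlast
          · obtain ⟨g, rfl⟩ := hps
            subst hc
            obtain ⟨z, hz, hzl, hiz⟩ :=
              DEE.exists_obar_dropLast (g := g) hc0 hu0 hu.2.1 hpp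
            refine Or.inr (record z hz hzl (Or.inr ?_))
            convert hiz using 1
            rw [hlast]
            simp
            omega
        · have h := (DEE.mem_occ_dropLast_iff hu0).2 ⟨hiu, hlast⟩
          exact Or.inr (record u (DEE.isPalSub_of_mem_occ hu0 hu.2.1 h) rfl (Or.inl h))
      · have h : k ∈ DEE.occ s.dropLast u := by
          refine (DEE.mem_occ_dropLast_iff hu0).2 ⟨hk, ?_⟩
          have := hu.2.2.length_le
          dsimp only at hilast
          omega
        exact Or.inr (record u (DEE.isPalSub_of_mem_occ hu0 hu.2.1 h) rfl
          (Or.inr ⟨k, h, rfl⟩))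
  · apply Set.union_subset
    · have hdiff : S v \ {s.length - v.length + 1} ⊆ DEE.occ s.dropLast v := fun i hi =>
        (DEE.mem_occ_dropLast_iff hv0).2 ⟨by rw [hSv]; exact Or.inl hi.1, hi.2⟩
      dsimp only
      split_ifs with hcond
      · refine Set.union_subset hdiff ?_
        rintro _ rfl
        obtain ⟨rfl, -⟩ := hcond
        have hlt := DEE.length_link_lt hp0
        have := hps.length_le
        refine (DEE.mem_occ_dropLast_iff hv0).2 ⟨DEE.occ_subset_occ_link hp0 hpp ?_, by omega⟩
        obtain ⟨g, rfl⟩ := hps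
        exact DEE.mem_occ_iff.2 ⟨g, [], by simp, by simp⟩
      · exact hdiff
    · refine Set.iUnion₂_subset ?_
      rintro u ⟨hu, rfl⟩
      exact Set.union_subset (DEE.occ_subset_occ_link hu.1 hu.2.1) (DEE.obar_subset_occ_link _ u)
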